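/- arXiv:1509.04174 — 2 statements merged into one kernel-verified Lean document; each statement's English description precedes it below -/
import Mathlib

section
/- The strict inequality ∫₀^{2π} √(2−2cos φ)·(2 sin φ − φ cos φ − φ)/φ⁴ dφ < ∫₀^{3π/2} √((2−2cos φ)/φ² − 8/(9π²))·(2 sin φ − φ cos φ − φ)/φ³ dφ holds between these two (well-defined) improper Riemann integrals of real-valued functions on (0,2π] and (0,3π/2] respectively. -/
open Real

lemma sl_nonneg_of_deriv (f f' : ℝ → ℝ) (h0 : f 0 = 0) (hd : ∀ x, HasDerivAt f (f' x) x)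
    (hf : ∀ x, 0 ≤ x → 0 ≤ f' x) (x : ℝ) (hx : 0 ≤ x) : 0 ≤ f x := by
  have hm : MonotoneOn f (Set.Ici 0) := by
    apply monotoneOn_of_deriv_nonneg (convex_Ici 0)
    · exact fun y _ => (hd y).continuousAt.continuousWithinAt
    · exact fun y _ => (hd y).differentiableAt.differentiableWithinAt
    · intro y hy
      rw [interior_Ici] at hy
      rw [(hd y).deriv]
      exact hf y (le_of_lt hy)
  have := hm (Set.mem_Ici.2 le_rfl) (Set.mem_Ici.2 hx) hx
  rw [h0] at this
  exact this

lemma sl_cos_ge2 (x : ℝ) : 1 - x^2/2 ≤ cos x := one_sub_sq_div_two_le_cos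

lemma sl_sin_ge3 (x : ℝ) (hx : 0 ≤ x) : x - x^3/6 ≤ sin x := by
  have := sl_nonneg_of_deriv (fun x => sin x - (x - x^3/6)) (fun x => cos x - (1 - x^2/2))
    (by simp) (fun x => by
      have := (hasDerivAt_sin x).sub ((hasDerivAt_id x).sub ((hasDerivAt_pow 3 x).div_const 6))
      refine this.congr_deriv ?_
      norm_num; ring)
    (fun x hx => by linarith [sl_cos_ge2 x]) x hx
  linarith

lemma sl_cos_le4 (x : ℝ) (hx : 0 ≤ x) : cos x ≤ 1 - x^2/2 + x^4/24 := by
  have := sl_nonneg_of_deriv (fun x => (1 - x^2/2 + x^4/24) - cos x)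
    (fun x => sin x - (x - x^3/6))
    (by simp) (fun x => by
      have := ((((hasDerivAt_pow 2 x).div_const 2).const_sub 1).add
        ((hasDerivAt_pow 4 x).div_const 24)).sub (hasDerivAt_cos x)
      refine this.congr_deriv ?_
      norm_num; ring)
    (fun x hx => by linarith [sl_sin_ge3 x hx]) x hx
  linarith

lemma sl_sin_le5 (x : ℝ) (hx : 0 ≤ x) : sin x ≤ x - x^3/6 + x^5/120 := by
  have := sl_nonneg_of_deriv (fun x => (x - x^3/6 + x^5/120) - sin x)
    (fun x => (1 - x^2/2 + x^4/24) - cos x)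
    (by simp) (fun x => by
      have := (((hasDerivAt_id x).sub ((hasDerivAt_pow 3 x).div_const 6)).add
        ((hasDerivAt_pow 5 x).div_const 120)).sub (hasDerivAt_sin x)
      refine this.congr_deriv ?_
      norm_num; ring)
    (fun x hx => by linarith [sl_cos_le4 x hx]) x hx
  linarith

lemma sl_cos_ge6 (x : ℝ) (hx : 0 ≤ x) : 1 - x^2/2 + x^4/24 - x^6/720 ≤ cos x := by
  have := sl_nonneg_of_deriv (fun x => cos x - (1 - x^2/2 + x^4/24 - x^6/720))
    (fun x => (x - x^3/6 + x^5/120) - sin x)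
    (by simp) (fun x => by
      have := (hasDerivAt_cos x).sub (((((hasDerivAt_pow 2 x).div_const 2).const_sub 1).add
        ((hasDerivAt_pow 4 x).div_const 24)).sub ((hasDerivAt_pow 6 x).div_const 720))
      refine this.congr_deriv ?_
      norm_num; ring)
    (fun x hx => by linarith [sl_sin_le5 x hx]) x hx
  linarith

lemma sl_sin_ge7 (x : ℝ) (hx : 0 ≤ x) : x - x^3/6 + x^5/120 - x^7/5040 ≤ sin x := by
  have := sl_nonneg_of_deriv (fun x => sin x - (x - x^3/6 + x^5/120 - x^7/5040))
    (fun x => cos x - (1 - x^2/2 + x^4/24 - x^6/720))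
    (by simp) (fun x => by
      have := (hasDerivAt_sin x).sub ((((hasDerivAt_id x).sub
        ((hasDerivAt_pow 3 x).div_const 6)).add
        ((hasDerivAt_pow 5 x).div_const 120)).sub ((hasDerivAt_pow 7 x).div_const 5040))
      refine this.congr_deriv ?_
      norm_num; ring)
    (fun x hx => by linarith [sl_cos_ge6 x hx]) x hx
  linarith

lemma sl_hasDeriv_g (x : ℝ) : HasDerivAt (fun x => sin x - x * cos x) (x * sin x) x := by
  have := (hasDerivAt_sin x).sub ((hasDerivAt_id x).mul (hasDerivAt_cos x))
  refine this.congr_deriv ?_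
  simp

lemma sl_g_le7 (x : ℝ) (hx : 0 ≤ x) : sin x - x * cos x ≤ x^3/3 - x^5/30 + x^7/840 := by
  have := sl_nonneg_of_deriv (fun x => (x^3/3 - x^5/30 + x^7/840) - (sin x - x * cos x))
    (fun x => x * ((x - x^3/6 + x^5/120) - sin x))
    (by simp) (fun x => by
      have := ((((hasDerivAt_pow 3 x).div_const 3).sub
        ((hasDerivAt_pow 5 x).div_const 30)).add ((hasDerivAt_pow 7 x).div_const 840)).sub
        (sl_hasDeriv_g x)
      refine this.congr_deriv ?_
      norm_num; ring)
    (fun x hx => mul_nonneg hx (by linarith [sl_sin_le5 x hx])) x hx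
  linarith

lemma sl_g_le3 (x : ℝ) (hx : 0 ≤ x) : sin x - x * cos x ≤ x^3/3 := by
  have := sl_nonneg_of_deriv (fun x => x^3/3 - (sin x - x * cos x))
    (fun x => x * (x - sin x))
    (by simp) (fun x => by
      have := ((hasDerivAt_pow 3 x).div_const 3).sub (sl_hasDeriv_g x)
      refine this.congr_deriv ?_
      norm_num; ring)
    (fun x hx => mul_nonneg hx (by linarith [sin_le hx])) x hx
  linarith

lemma sl_g_nonneg (x : ℝ) (hx : 0 ≤ x) (hx' : x ≤ π) : 0 ≤ sin x - x * cos x := by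
  have hm : MonotoneOn (fun x => sin x - x * cos x) (Set.Icc 0 π) := by
    apply monotoneOn_of_deriv_nonneg (convex_Icc 0 π)
    · exact fun y _ => (sl_hasDeriv_g y).continuousAt.continuousWithinAt
    · exact fun y _ => (sl_hasDeriv_g y).differentiableAt.differentiableWithinAt
    · intro y hy
      rw [interior_Icc] at hy
      rw [(sl_hasDeriv_g y).deriv]
      exact mul_nonneg hy.1.le (sin_nonneg_of_nonneg_of_le_pi hy.1.le hy.2.le)
  have := hm (Set.mem_Icc.2 ⟨le_rfl, pi_pos.le⟩) (Set.mem_Icc.2 ⟨hx, hx'⟩) hx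
  simpa using this

noncomputable def slu (t : ℝ) : ℝ := sin t / t
noncomputable def slh (t : ℝ) : ℝ := cos t * (sin t - t * cos t) / t^3
noncomputable def sla : ℝ := 2 * √2 / (3 * π)
noncomputable def sls (t : ℝ) : ℝ := √(slu t ^ 2 - sla ^ 2)

lemma sla_sq : sla ^ 2 = 8 / (9 * π^2) := by
  unfold sla
  rw [div_pow, mul_pow, mul_pow, sq_sqrt (by norm_num)]; norm_num

lemma sl_u_deriv (t : ℝ) (ht : 0 < t) :
    HasDerivAt slu (-((sin t - t * cos t) / t^2)) t := by
  have := (hasDerivAt_sin t).div (hasDerivAt_id t) ht.ne'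
  refine this.congr_deriv ?_
  simp only [id]
  field_simp
  ring

lemma sl_u_anti : AntitoneOn slu (Set.Ioc 0 π) := by
  apply antitoneOn_of_deriv_nonpos (convex_Ioc 0 π)
  · exact fun y hy => (sl_u_deriv y hy.1).continuousAt.continuousWithinAt
  · intro y hy
    rw [interior_Ioc] at hy
    exact (sl_u_deriv y hy.1).differentiableAt.differentiableWithinAt
  · intro y hy
    rw [interior_Ioc] at hy
    rw [(sl_u_deriv y hy.1).deriv]
    have := sl_g_nonneg y hy.1.le hy.2.le
    have : 0 ≤ (sin y - y * cos y) / y^2 := by positivity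
    linarith

lemma sl_u_half : slu (π/2) = 2/π := by
  unfold slu; rw [sin_pi_div_two]; field_simp

lemma sl_sin34 : sin (3*π/4) = √2/2 := by
  rw [show 3*π/4 = π - π/4 by ring, sin_pi_sub, sin_pi_div_four]

lemma sl_u_34 : slu (3*π/4) = sla := by
  unfold slu sla; rw [sl_sin34]; have := pi_pos; field_simp; ring

lemma sl_u_pi : slu π = 0 := by simp [slu]

lemma sl_a_pos : 0 < sla := by unfold sla; positivity

lemma sl_a_bounds : 0.3 < sla ∧ sla < 0.3002 := by
  have h1 := pi_gt_d4
  have h2 := pi_lt_d4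
  have h3 : (1.4142:ℝ) < √2 := by apply lt_sqrt_of_sq_lt; norm_num
  have h4 : √2 < (1.4143:ℝ) := by rw [sqrt_lt' (by norm_num)]; norm_num
  unfold sla
  constructor
  · rw [lt_div_iff₀ (by positivity)]; linarith
  · rw [div_lt_iff₀ (by positivity)]; linarith

lemma sl_b_bounds : 0.6366 < 2/π ∧ 2/π < 0.6367 := by
  have h1 := pi_gt_d4
  have h2 := pi_lt_d4
  constructor
  · rw [lt_div_iff₀ (by positivity)]; linarith
  · rw [div_lt_iff₀ (by positivity)]; linarith

lemma sl_keyA (t : ℝ) (ht : 0 < t) (ht' : t ≤ π/2) :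
    cos t * (sin t - t * cos t) ≤ sin t * (t^2 * (1/3 - 0.13 * t^2)) := by
  have hp := pi_lt_d4
  have hy : t^2 ≤ 2.4675 := by nlinarith
  have hc0 : 0 ≤ cos t := cos_nonneg_of_mem_Icc ⟨by linarith, ht'⟩
  have h1 := sl_cos_le4 t ht.le
  have h2 := sl_g_le7 t ht.le
  have h3 := sl_sin_ge7 t ht.le
  have hg := sl_g_nonneg t ht.le (by linarith [pi_pos])
  have e1 : cos t * (sin t - t * cos t)
      ≤ (1 - t^2/2 + t^4/24) * (t^3/3 - t^5/30 + t^7/840) :=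
    mul_le_mul h1 h2 hg (hc0.trans h1)
  have e2 : (t - t^3/6 + t^5/120 - t^7/5040) * (t^2 * (1/3 - 0.13 * t^2))
      ≤ sin t * (t^2 * (1/3 - 0.13 * t^2)) := by
    apply mul_le_mul_of_nonneg_right h3
    apply mul_nonneg (by positivity); linarith
  have e3 : (1 - t^2/2 + t^4/24) * (t^3/3 - t^5/30 + t^7/840)
      ≤ (t - t^3/6 + t^5/120 - t^7/5040) * (t^2 * (1/3 - 0.13 * t^2)) := by
    obtain ⟨y, hyd⟩ : ∃ y, y = t^2 := ⟨_, rfl⟩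
    rw [← hyd] at hy
    have hy0 : 0 ≤ y := by rw [hyd]; positivity
    have key : (1 - y/2 + y^2/24) * (1/3 - y/30 + y^2/840)
      ≤ (1 - y/6 + y^2/120 - y^3/5040) * (1/3 - 0.13 * y) := by
      have : 0 ≤ y * ((1/3*(1/2+0) + 1/30 - 1/18 - 0.13)
        + y * (0.13/6 + 1/360 - 1/72 - 1/60 - 1/840)
        + y^2 * (-0.13/120 - 1/15120 + 1/1680 + 1/720)
        + y^3 * (0.13/5040 - 1/20160)) := by
        apply mul_nonneg hy0
        norm_num
        nlinarith [sq_nonneg y, mul_nonneg hy0 hy0, mul_nonneg (mul_nonneg hy0 hy0) (sub_nonneg.2 hy)]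
      nlinarith [this]
    have := mul_le_mul_of_nonneg_left key (show 0 ≤ t^3 by positivity)
    rw [hyd] at this
    nlinarith [this]
  linarith

lemma sl_keyB (t : ℝ) (ht : π/2 ≤ t) (ht' : t ≤ 3*π/4) :
    0.86 * (2/π - slu t) ≤ - cos t / t := by
  have hp := pi_gt_d4
  have hp' := pi_lt_d4
  have ht0 : 0 < t := by linarith
  obtain ⟨s, rfl⟩ : ∃ s, t = s + π/2 := ⟨t - π/2, by ring⟩
  have hs : 0 ≤ s := by linarith
  have hs' : s ≤ π/4 := by linarith
  unfold slu
  rw [cos_add_pi_div_two, sin_add_pi_div_two, le_div_iff₀ ht0]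
  have : 0.86 * (2/π - cos s/(s+π/2)) * (s+π/2) = 0.86 * (2/π) * s + 0.86 - 0.86 * cos s := by
    field_simp
  rw [this]
  have h1 := sl_sin_ge3 s hs
  have h2 := sl_cos_ge2 s
  have h3 := sl_b_bounds.2
  have h4 : 2/π * s ≤ 0.6367 * s := mul_le_mul_of_nonneg_right h3.le hs
  have h5 : 0 ≤ s * (0.452 - 0.43 * s - s^2/6) := by
    apply mul_nonneg hs; nlinarith
  nlinarith

lemma sl_keyC (t : ℝ) (ht : 3*π/4 ≤ t) (ht' : t ≤ π) : 0.29 ≤ - cos t / t := by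
  have hp := pi_gt_d4
  have hp' := pi_lt_d4
  have ht0 : 0 < t := by linarith
  rw [le_div_iff₀ ht0, ← cos_pi_sub]
  have := sl_cos_ge2 (π - t)
  have h1 : 0 ≤ π - t := by linarith
  have h2 : π - t ≤ 0.7855 := by linarith
  nlinarith

lemma sl_ptA (t : ℝ) (ht : 0 < t) (ht' : t ≤ π/2) :
    -(sla^2/1.88 * (1/3 - 0.13 * t^2)) ≤ (sls t - slu t) * slh t := by
  have hpi := pi_pos
  have hs0 : 0 < sin t := sin_pos_of_pos_of_lt_pi ht (by linarith)
  have hu0 : 0 < slu t := div_pos hs0 ht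
  have hu : 2/π ≤ slu t := by
    unfold slu; rw [le_div_iff₀ ht]; exact mul_le_sin ht.le ht'
  have ha : sla^2 = 2/9 * (2/π)^2 := by rw [sla_sq]; field_simp; norm_num
  have hb0 : 0 < 2/π := by positivity
  have hle : sla^2 ≤ 0.2256 * slu t^2 := by
    rw [ha]; have : (2/π)^2 ≤ slu t^2 := by gcongr
    nlinarith
  have hsq : sls t ^ 2 = slu t^2 - sla^2 := sq_sqrt (by nlinarith)
  have hs : 0.88 * slu t ≤ sls t := le_sqrt_of_sq_le (by nlinarith)
  have hsu : slu t - sls t ≤ sla^2/1.88 / slu t := by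
    rw [le_div_iff₀ hu0, le_div_iff₀ (by norm_num)]
    have : sls t ≤ slu t := by
      apply sqrt_le_iff.2 ⟨hu0.le, by nlinarith [sq_nonneg sla]⟩
    nlinarith
  have hc0 : 0 ≤ cos t := cos_nonneg_of_mem_Icc ⟨by linarith, ht'⟩
  have hg := sl_g_nonneg t ht.le (by linarith)
  have hh0 : 0 ≤ slh t := by unfold slh; positivity
  have h1 : slh t / slu t ≤ 1/3 - 0.13 * t^2 := by
    rw [div_le_iff₀ hu0]
    unfold slh slu
    rw [div_le_iff₀ (by positivity)]
    refine (sl_keyA t ht ht').trans (le_of_eq ?_)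
    field_simp
  have h2 := mul_le_mul_of_nonneg_right hsu hh0
  have h3 := mul_le_mul_of_nonneg_left h1 (show 0 ≤ sla^2/1.88 by positivity)
  have h4 : sla^2/1.88 / slu t * slh t = sla^2/1.88 * (slh t / slu t) := by ring
  linarith

lemma sl_h_eq (t : ℝ) (ht : 0 < t) :
    - slh t = (- cos t / t) * ((sin t - t * cos t) / t^2) := by
  unfold slh; field_simp

lemma sl_ptB (t : ℝ) (ht : π/2 ≤ t) (ht' : t ≤ 3*π/4) :
    (0.86 / (2 * (2/π - sla)) * ((2/π - slu t)^2 * (2 * sla - (2/π - slu t))))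
      * ((sin t - t * cos t) / t^2) ≤ (sls t - slu t) * slh t := by
  have hpi := pi_pos
  have ht0 : 0 < t := by linarith
  have hu1 : slu t ≤ 2/π := by
    rw [← sl_u_half]
    exact sl_u_anti ⟨by linarith, by linarith⟩ ⟨ht0, by linarith⟩ ht
  have hu2 : sla ≤ slu t := by
    rw [← sl_u_34]
    exact sl_u_anti ⟨ht0, by linarith⟩ ⟨by linarith, by linarith⟩ ht'
  have ha := sl_a_bounds
  have hb := sl_b_bounds
  have hB := sl_keyB t ht ht'
  have hg := sl_g_nonneg t ht0.le (by linarith)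
  have hG : 0 ≤ (sin t - t * cos t) / t^2 := by positivity
  have hsq : sls t ^ 2 = slu t^2 - sla^2 := sq_sqrt (by nlinarith)
  have hm : 0 < 2/π - sla := by linarith
  have hp : (2/π - slu t) * (2 * sla - (2/π - slu t)) / (2 * (2/π - sla)) ≤ slu t - sls t := by
    rw [div_le_iff₀ (by linarith)]
    nlinarith [sq_nonneg (sls t - (2/π - sla))]
  have hp0 : 0 ≤ (2/π - slu t) * (2 * sla - (2/π - slu t)) / (2 * (2/π - sla)) := by
    apply div_nonneg (mul_nonneg _ _) <;> linarith
  have h1 := mul_le_mul hp hB (by linarith) (hp0.trans hp)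
  have h2 := mul_le_mul_of_nonneg_right h1 hG
  have h3 : (sls t - slu t) * slh t = (slu t - sls t) * (- slh t) := by ring
  rw [h3, sl_h_eq t ht0]
  refine le_trans (le_of_eq ?_) (h2.trans (le_of_eq ?_)) <;> ring

lemma sl_ptC (t : ℝ) (ht : 3*π/4 ≤ t) (ht' : t ≤ π) :
    0.29 * slu t * ((sin t - t * cos t) / t^2) ≤ - (slu t * slh t) := by
  have hpi := pi_pos
  have ht0 : 0 < t := by linarith
  have hg := sl_g_nonneg t ht0.le ht'
  have hG : 0 ≤ (sin t - t * cos t) / t^2 := by positivity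
  have hu : 0 ≤ slu t := div_nonneg (sin_nonneg_of_nonneg_of_le_pi ht0.le ht') ht0.le
  have h1 := mul_le_mul_of_nonneg_right (mul_le_mul_of_nonneg_left (sl_keyC t ht ht') hu) hG
  have h3 : - (slu t * slh t) = slu t * (- slh t) := by ring
  rw [h3, sl_h_eq t ht0]
  linarith

lemma sl_h_abs (t : ℝ) (ht : 0 < t) (ht' : t ≤ π) : |slh t| ≤ 1/3 := by
  unfold slh
  rw [abs_div, abs_mul, abs_of_pos (show 0 < t^3 by positivity),
    abs_of_nonneg (sl_g_nonneg t ht.le ht'), div_le_iff₀ (by positivity)]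
  have h1 := sl_g_le3 t ht.le
  have h2 := abs_cos_le_one t
  have h3 := mul_le_mul h2 h1 (sl_g_nonneg t ht.le ht') zero_le_one
  linarith

lemma sl_u_abs (t : ℝ) (ht : 0 < t) : |slu t| ≤ 1 := by
  unfold slu
  rw [abs_div, abs_of_pos ht, div_le_iff₀ ht, one_mul]
  have := abs_sin_le_abs (x := t)
  rwa [abs_of_pos ht] at this

lemma sl_s_abs (t : ℝ) (ht : 0 < t) : |sls t| ≤ 1 := by
  unfold sls
  rw [abs_of_nonneg (sqrt_nonneg _), sqrt_le_iff]
  refine ⟨zero_le_one, ?_⟩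
  have := sl_u_abs t ht
  have : slu t ^ 2 ≤ 1 := by rw [← sq_abs]; nlinarith [abs_nonneg (slu t)]
  nlinarith [sq_nonneg sla]

lemma sl_u_meas : Measurable slu := by unfold slu; fun_prop
lemma sl_h_meas : Measurable slh := by unfold slh; fun_prop
lemma sl_s_meas : Measurable sls := by
  have := sl_u_meas
  unfold sls; fun_prop

lemma sl_ii (f : ℝ → ℝ) (hf : Measurable f) (hb : ∀ t, 0 < t → |f t| ≤ 1) (x y : ℝ)
    (hx : 0 ≤ x) (hxy : x ≤ y) (hy : y ≤ π) :
    IntervalIntegrable (fun t => f t * slh t) MeasureTheory.volume x y := by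
  rw [intervalIntegrable_iff_integrableOn_Ioc_of_le hxy]
  apply MeasureTheory.Measure.integrableOn_of_bounded (M := 1/3)
  · simp
  · exact (hf.mul sl_h_meas).aestronglyMeasurable
  · filter_upwards [MeasureTheory.ae_restrict_mem measurableSet_Ioc] with t ht
    have h0 : 0 < t := lt_of_le_of_lt hx ht.1
    rw [norm_mul]
    have h1 := mul_le_mul (hb t h0) (sl_h_abs t h0 (ht.2.trans hy)) (abs_nonneg _) zero_le_one
    simpa using h1

lemma sl_iu (x y : ℝ) (hx : 0 ≤ x) (hxy : x ≤ y) (hy : y ≤ π) :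
    IntervalIntegrable (fun t => slu t * slh t) MeasureTheory.volume x y :=
  sl_ii slu sl_u_meas sl_u_abs x y hx hxy hy

lemma sl_is (x y : ℝ) (hx : 0 ≤ x) (hxy : x ≤ y) (hy : y ≤ π) :
    IntervalIntegrable (fun t => sls t * slh t) MeasureTheory.volume x y :=
  sl_ii sls sl_s_meas sl_s_abs x y hx hxy hy

lemma sl_id (x y : ℝ) (hx : 0 ≤ x) (hxy : x ≤ y) (hy : y ≤ π) :
    IntervalIntegrable (fun t => (sls t - slu t) * slh t) MeasureTheory.volume x y := by
  have := (sl_is x y hx hxy hy).sub (sl_iu x y hx hxy hy)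
  refine this.congr ?_
  intro t _
  simp only; ring

lemma sl_intA : -(sla^2/1.88 * (π/6 - 0.13 * π^3/24)) ≤
    ∫ t in (0:ℝ)..(π/2), (sls t - slu t) * slh t := by
  have hpi := pi_pos
  have h : ∫ t in (0:ℝ)..(π/2), -(sla^2/1.88 * (1/3 - 0.13 * t^2)) =
      -(sla^2/1.88 * (π/6 - 0.13 * π^3/24)) := by
    rw [intervalIntegral.integral_neg, intervalIntegral.integral_const_mul,
      intervalIntegral.integral_sub (by simp) ((Continuous.intervalIntegrable (by fun_prop)) _ _),
      intervalIntegral.integral_const_mul, integral_pow]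
    rw [intervalIntegral.integral_const, smul_eq_mul]; norm_num; left; ring
  rw [← h]
  apply intervalIntegral.integral_mono_on_of_le_Ioo (by linarith)
    (Continuous.intervalIntegrable (by fun_prop) _ _)
    (sl_id 0 (π/2) le_rfl (by linarith) (by linarith))
  intro t ht
  exact sl_ptA t ht.1 ht.2.le

lemma sl_g_cont (x y : ℝ) (hx : 0 < x) :
    ContinuousOn (fun t : ℝ => (sin t - t * cos t) / t^2) (Set.Icc x y) := by
  apply ContinuousOn.div (by fun_prop) (by fun_prop)
  intro t ht
  have : 0 < t := lt_of_lt_of_le hx ht.1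
  positivity

lemma sl_u_cont (x y : ℝ) (hx : 0 < x) : ContinuousOn slu (Set.Icc x y) :=
  fun t ht => (sl_u_deriv t (lt_of_lt_of_le hx ht.1)).continuousAt.continuousWithinAt

lemma sl_intB : 0.86 * (2/π - sla)^2 * (sla/3 - (2/π - sla)/8) ≤
    ∫ t in (π/2)..(3*π/4), (sls t - slu t) * slh t := by
  have hpi := pi_pos
  have hm : 0 < 2/π - sla := by linarith [sl_a_bounds.2, sl_b_bounds.1]
  have hle : π/2 ≤ 3*π/4 := by linarith
  have hi : IntervalIntegrable (fun t =>
      (0.86 / (2 * (2/π - sla)) * ((2/π - slu t)^2 * (2 * sla - (2/π - slu t))))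
      * ((sin t - t * cos t) / t^2)) MeasureTheory.volume (π/2) (3*π/4) := by
    apply ContinuousOn.intervalIntegrable
    rw [Set.uIcc_of_le hle]
    have h1 := sl_g_cont (π/2) (3*π/4) (by linarith)
    have h2 := sl_u_cont (π/2) (3*π/4) (by linarith)
    exact ContinuousOn.mul (by fun_prop) h1
  have h : ∫ t in (π/2)..(3*π/4),
      (0.86 / (2 * (2/π - sla)) * ((2/π - slu t)^2 * (2 * sla - (2/π - slu t))))
      * ((sin t - t * cos t) / t^2) =
      0.86 * (2/π - sla)^2 * (sla/3 - (2/π - sla)/8) := by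
    rw [intervalIntegral.integral_eq_sub_of_hasDerivAt
      (f := fun t => 0.86 / (2 * (2/π - sla)) *
        (2 * sla * (2/π - slu t)^3 / 3 - (2/π - slu t)^4/4)) _ hi]
    · rw [sl_u_half, sl_u_34]
      obtain ⟨m, hmd⟩ : ∃ m, m = 2/π - sla := ⟨_, rfl⟩
      rw [← hmd] at hm ⊢
      field_simp
      ring
    · intro t ht
      rw [Set.uIcc_of_le hle] at ht
      have hu := (sl_u_deriv t (by linarith [ht.1])).const_sub (2/π)
      have := ((((hu.pow 3).const_mul (2 * sla)).div_const 3).sub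
        ((hu.pow 4).div_const 4)).const_mul (0.86 / (2 * (2/π - sla)))
      refine this.congr_deriv ?_
      norm_num
      ring
  rw [← h]
  apply intervalIntegral.integral_mono_on hle hi
    (sl_id _ _ (by linarith) hle (by linarith))
  intro t ht
  exact sl_ptB t ht.1 ht.2

lemma sl_intC : 0.29 * sla^2/2 ≤ ∫ t in (3*π/4)..π, -(slu t * slh t) := by
  have hpi := pi_pos
  have hle : 3*π/4 ≤ π := by linarith
  have hi : IntervalIntegrable (fun t =>
      0.29 * slu t * ((sin t - t * cos t) / t^2)) MeasureTheory.volume (3*π/4) π := by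
    apply ContinuousOn.intervalIntegrable
    rw [Set.uIcc_of_le hle]
    have h1 := sl_g_cont (3*π/4) π (by linarith)
    have h2 := sl_u_cont (3*π/4) π (by linarith)
    exact ContinuousOn.mul (by fun_prop) h1
  have h : ∫ t in (3*π/4)..π, 0.29 * slu t * ((sin t - t * cos t) / t^2) = 0.29 * sla^2/2 := by
    rw [intervalIntegral.integral_eq_sub_of_hasDerivAt
      (f := fun t => -(0.29 * (slu t)^2 / 2)) _ hi]
    · rw [sl_u_pi, sl_u_34]; ring
    · intro t ht
      rw [Set.uIcc_of_le hle] at ht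
      have := ((((sl_u_deriv t (by linarith [ht.1])).pow 2).const_mul 0.29).div_const 2).neg
      refine this.congr_deriv ?_
      norm_num
      ring
  rw [← h]
  apply intervalIntegral.integral_mono_on hle hi
    (sl_iu _ _ (by linarith) hle le_rfl).neg
  intro t ht
  exact sl_ptC t ht.1 ht.2

lemma sl_main : ∫ t in (0:ℝ)..π, slu t * slh t < ∫ t in (0:ℝ)..(3*π/4), sls t * slh t := by
  have hpi := pi_pos
  have e1 : ∫ t in (0:ℝ)..π, slu t * slh t =
      (∫ t in (0:ℝ)..(3*π/4), slu t * slh t) + ∫ t in (3*π/4)..π, slu t * slh t :=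
    (intervalIntegral.integral_add_adjacent_intervals
      (sl_iu _ _ le_rfl (by linarith) (by linarith))
      (sl_iu _ _ (by linarith) (by linarith) le_rfl)).symm
  have e2 : ∫ t in (0:ℝ)..(3*π/4), (sls t - slu t) * slh t =
      (∫ t in (0:ℝ)..(3*π/4), sls t * slh t) - ∫ t in (0:ℝ)..(3*π/4), slu t * slh t := by
    rw [← intervalIntegral.integral_sub (sl_is _ _ le_rfl (by linarith) (by linarith))
      (sl_iu _ _ le_rfl (by linarith) (by linarith))]
    congr 1; ext t; ring
  have e3 := intervalIntegral.integral_add_adjacent_intervals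
      (sl_id 0 (π/2) le_rfl (by linarith) (by linarith))
      (sl_id (π/2) (3*π/4) (by linarith) (by linarith) (by linarith))
  have hA := sl_intA
  have hB := sl_intB
  have hC := sl_intC
  rw [intervalIntegral.integral_neg] at hC
  obtain ⟨ha, ha'⟩ := sl_a_bounds
  obtain ⟨hb, hb'⟩ := sl_b_bounds
  have n1 : sla^2 ≤ 0.09013 := by nlinarith
  have n2 : 0.09 ≤ sla^2 := by nlinarith
  have n3 : π/6 - 0.13 * π^3/24 ≤ 0.3558 := by
    have h1 := pi_gt_d4
    have h2 := pi_lt_d4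
    have : (3.1415:ℝ)^3 ≤ π^3 := by gcongr
    norm_num at this ⊢
    linarith
  have n4 : sla^2/1.88 * (π/6 - 0.13 * π^3/24) ≤ 0.09013/1.88 * 0.3558 := by
    calc _ ≤ sla^2/1.88 * 0.3558 := by gcongr
      _ ≤ _ := by gcongr
  have n5 : 0.86 * 0.3364^2 * (0.3/3 - 0.3367/8) ≤
      0.86 * (2/π - sla)^2 * (sla/3 - (2/π - sla)/8) := by
    gcongr <;> linarith
  norm_num at n4 n5 hC hB hA
  linarith

lemma sl_left : (∫ φ in (0:ℝ)..(2*π),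
        Real.sqrt (2 - 2*Real.cos φ) * (2*Real.sin φ - φ*Real.cos φ - φ) / φ^4)
    = ∫ t in (0:ℝ)..π, slu t * slh t := by
  have h := intervalIntegral.mul_integral_comp_mul_left (a := 0) (b := π) (c := 2)
    (f := fun φ => Real.sqrt (2 - 2*Real.cos φ) * (2*Real.sin φ - φ*Real.cos φ - φ) / φ^4)
  rw [mul_zero] at h
  rw [← h, ← intervalIntegral.integral_const_mul]
  apply intervalIntegral.integral_congr
  intro t ht
  rw [Set.uIcc_of_le pi_pos.le] at ht
  simp only
  have hs := sin_nonneg_of_nonneg_of_le_pi ht.1 ht.2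
  have e : 2 - 2 * cos (2*t) = (2 * sin t)^2 := by
    rw [cos_two_mul, mul_pow, sin_sq]; ring
  rw [e, sqrt_sq (by positivity), cos_two_mul, sin_two_mul]
  unfold slu slh
  rcases ht.1.eq_or_lt with h0 | h0
  · rw [← h0]; simp
  · field_simp
    ring

lemma sl_right : (∫ φ in (0:ℝ)..(3*π/2),
        Real.sqrt ((2 - 2*Real.cos φ)/φ^2 - 8/(9*π^2)) *
          (2*Real.sin φ - φ*Real.cos φ - φ) / φ^3)
    = ∫ t in (0:ℝ)..(3*π/4), sls t * slh t := by
  have h := intervalIntegral.mul_integral_comp_mul_left (a := 0) (b := 3*π/4) (c := 2)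
    (f := fun φ => Real.sqrt ((2 - 2*Real.cos φ)/φ^2 - 8/(9*π^2)) *
          (2*Real.sin φ - φ*Real.cos φ - φ) / φ^3)
  rw [mul_zero, show 2 * (3*π/4) = 3*π/2 by ring] at h
  rw [← h, ← intervalIntegral.integral_const_mul]
  apply intervalIntegral.integral_congr
  intro t ht
  have e : (2 - 2 * cos (2*t))/(2*t)^2 - 8/(9*π^2) = slu t^2 - sla^2 := by
    rw [cos_two_mul, sla_sq, slu, div_pow, sin_sq]
    congr 1
    rcases eq_or_ne t 0 with h0 | h0
    · rw [h0]; simp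
    · field_simp; ring
  simp only
  rw [e, cos_two_mul, sin_two_mul]
  unfold sls slh
  rcases eq_or_ne t 0 with h0 | h0
  · rw [h0]; simp
  · field_simp
    ring

/-- The strict inequality between the two improper integrals: the area integral for the
central vertical slice of the sub-Riemannian unit ball is strictly less than that for the
slice by the plane `{y = 2√2/(3π)}`. -/
theorem integral_slice_lt :
    (∫ φ in (0:ℝ)..(2*π),
        Real.sqrt (2 - 2*Real.cos φ) * (2*Real.sin φ - φ*Real.cos φ - φ) / φ^4)
    < ∫ φ in (0:ℝ)..(3*π/2),
        Real.sqrt ((2 - 2*Real.cos φ)/φ^2 - 8/(9*π^2)) *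
          (2*Real.sin φ - φ*Real.cos φ - φ) / φ^3 := by
  rw [sl_left, sl_right]
  exact sl_main
end

section
/- The two integrals satisfy ∫₀^{2π} √(2−2cos φ)·(2 sin φ − φ cos φ − φ)/φ⁴ dφ < ∫₀^{3π/2} √((2−2cos φ)/φ² − 8/(9π²))·(2 sin φ − φ cos φ − φ)/φ³ dφ, and both are strictly positive; consequently the ratio of the first to the second is a real number strictly between 0 and 1. -/
open Real
lemma poly_p1 {u : ℝ} (h0 : 0 < u) (h1 : u < 7854/10000) : 4/10 * (15708/10000+u)^2 ≤ (1 - u^2/6) * (1 + (157075/100000+u) * (u - u^3/6)) := by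
  have a := mul_pos h0 (sub_pos.2 h1)
  have b := mul_pos h0 a
  have c := mul_pos h0 b
  have d := mul_pos h0 c
  have e := mul_pos h0 d
  have f := mul_pos h0 e
  have g := pow_pos h0 6
  nlinarith
lemma poly_p2 {t : ℝ} (h0 : 0 < t) (h1 : t < 7854/10000) : (32/1000 + 18/1000*t) * (31416/10000 - t)^4
    ≤ (1 - t^2/6) * (1 - t^2/2) * ((t - t^3/6) + (31415/10000 - t) * (1 - t^2/2)) := by
  have a := mul_pos h0 (sub_pos.2 h1)
  have b := mul_pos h0 a
  have c := mul_pos h0 b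
  have d := mul_pos h0 c
  have e := mul_pos h0 d
  have f := mul_pos h0 e
  have g := mul_pos h0 f
  nlinarith
lemma poly_p3 {x : ℝ} (h0 : 157/100 < x) (h1 : x < 31416/10000) : 1/2 * (1 + x) ≤ (38/100 - 105/1000*x) * x^4 := by
  obtain ⟨v, rfl⟩ : ∃ v, x = 157/100 + v := ⟨x - 157/100, by ring⟩
  have h0 : 0 < v := by linarith
  have h1 : v < 15716/10000 := by linarith
  have a := mul_pos h0 (sub_pos.2 h1)
  have b := mul_pos h0 a
  have c := mul_pos h0 b
  have d := mul_pos h0 c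
  nlinarith

lemma aux_mono {f f' : ℝ → ℝ} (hd : ∀ x, HasDerivAt f (f' x) x) (h0 : f 0 = 0)
    (hp : ∀ x, 0 ≤ x → 0 ≤ f' x) {x : ℝ} (hx : 0 ≤ x) : 0 ≤ f x := by
  have hm : MonotoneOn f (Set.Ici 0) := by
    apply monotoneOn_of_deriv_nonneg (convex_Ici 0)
    · exact fun y _ => (hd y).continuousAt.continuousWithinAt
    · exact fun y _ => (hd y).differentiableAt.differentiableWithinAt
    · intro y hy
      rw [interior_Ici] at hy
      rw [(hd y).deriv]
      exact hp y (le_of_lt hy)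
  rw [← h0]
  exact hm (Set.self_mem_Ici) hx hx

lemma cos_up {x : ℝ} (hx : 0 ≤ x) : cos x ≤ 1 - x^2/2 + x^4/24 := by
  have := aux_mono (f := fun x => 1 - x^2/2 + x^4/24 - cos x)
    (f' := fun x => sin x - (x - x^3/6)) (fun x => by
      have h := ((((hasDerivAt_const x (1:ℝ)).sub ((hasDerivAt_pow 2 x).div_const 2)).add
        ((hasDerivAt_pow 4 x).div_const 24)).sub (hasDerivAt_cos x))
      refine h.congr_deriv ?_
      norm_num; ring) (by simp) (fun x hx => by linarith [sin_ge_sub_cube hx]) hx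
  linarith

lemma sin_up {x : ℝ} (hx : 0 ≤ x) : sin x ≤ x - x^3/6 + x^5/120 := by
  have := aux_mono (f := fun x => x - x^3/6 + x^5/120 - sin x)
    (f' := fun x => 1 - x^2/2 + x^4/24 - cos x) (fun x => by
      have h := ((((hasDerivAt_id x).sub ((hasDerivAt_pow 3 x).div_const 6)).add
        ((hasDerivAt_pow 5 x).div_const 120)).sub (hasDerivAt_sin x))
      refine h.congr_deriv ?_
      norm_num; ring) (by simp) (fun x hx => by linarith [cos_up hx]) hx
  linarith

lemma cos_low {x : ℝ} (hx : 0 ≤ x) : 1 - x^2/2 + x^4/24 - x^6/720 ≤ cos x := by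
  have := aux_mono (f := fun x => cos x - (1 - x^2/2 + x^4/24 - x^6/720))
    (f' := fun x => x - x^3/6 + x^5/120 - sin x) (fun x => by
      have h := ((hasDerivAt_cos x).sub ((((hasDerivAt_const x (1:ℝ)).sub
        ((hasDerivAt_pow 2 x).div_const 2)).add
        ((hasDerivAt_pow 4 x).div_const 24)).sub ((hasDerivAt_pow 6 x).div_const 720)))
      refine h.congr_deriv ?_
      norm_num; ring) (by simp) (fun x hx => by linarith [sin_up hx]) hx
  linarith

/-- `sin x - x cos x ≥ 0` on `[0, π]`. -/
lemma d_nonneg {x : ℝ} (hx : 0 ≤ x) (hx' : x ≤ π) : 0 ≤ sin x - x * cos x := by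
  have hm : MonotoneOn (fun x => sin x - x * cos x) (Set.Icc 0 π) := by
    have hd : ∀ y, HasDerivAt (fun x => sin x - x * cos x) (y * sin y) y := fun y => by
      have h := (hasDerivAt_sin y).sub ((hasDerivAt_id y).mul (hasDerivAt_cos y))
      refine h.congr_deriv ?_
      simp
    apply monotoneOn_of_deriv_nonneg (convex_Icc 0 π)
    · exact fun y _ => (hd y).continuousAt.continuousWithinAt
    · exact fun y _ => (hd y).differentiableAt.differentiableWithinAt
    · intro y hy
      rw [interior_Icc] at hy
      rw [(hd y).deriv]
      exact mul_nonneg hy.1.le (sin_nonneg_of_nonneg_of_le_pi hy.1.le hy.2.le)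
  have := hm (Set.left_mem_Icc.2 pi_pos.le) ⟨hx, hx'⟩ hx
  simpa using this

noncomputable def f1 (x : ℝ) : ℝ := sin x * cos x * (sin x - x * cos x) / x^4
noncomputable def f2 (x : ℝ) : ℝ :=
  √((sin x / x)^2 - 8/(9*π^2)) * (cos x * (sin x - x * cos x) / x^3)

lemma f1_eq (x : ℝ) : f1 x = (sin x / x) * (cos x * (sin x - x * cos x) / x^3) := by
  unfold f1; rw [div_mul_div_comm]; congr 1 <;> ring

lemma w_bound {x : ℝ} (hx : 0 < x) (hx' : x ≤ π) :
    |cos x * (sin x - x * cos x) / x^3| ≤ 1/2 := by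
  rw [abs_div, abs_mul, abs_of_nonneg (d_nonneg hx.le hx'), abs_of_pos (pow_pos hx 3),
    div_le_iff₀ (pow_pos hx 3)]
  have h1 := abs_cos_le_one x
  have h2 := d_nonneg hx.le hx'
  have h3 : sin x - x * cos x ≤ x^3/2 := by
    have := mul_le_mul_of_nonneg_left (one_sub_sq_div_two_le_cos (x := x)) hx.le
    have := sin_lt hx
    linarith
  nlinarith

lemma s_bound {x : ℝ} (hx : 0 < x) (hx' : x ≤ π) : 0 ≤ sin x / x ∧ sin x / x ≤ 1 :=
  ⟨div_nonneg (sin_nonneg_of_nonneg_of_le_pi hx.le hx') hx.le,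
    (div_le_one hx).2 (sin_lt hx).le⟩

lemma int_of_bd {f : ℝ → ℝ} (hm : Measurable f) (hb : ∀ x, 0 < x → x ≤ π → |f x| ≤ 1)
    {a b : ℝ} (ha : 0 ≤ a) (hab : a ≤ b) (hbp : b ≤ π) :
    IntervalIntegrable f MeasureTheory.volume a b := by
  rw [intervalIntegrable_iff_integrableOn_Ioc_of_le hab]
  apply MeasureTheory.Measure.integrableOn_of_bounded (M := 1)
  · simp
  · exact hm.aestronglyMeasurable
  · rw [MeasureTheory.ae_restrict_iff' measurableSet_Ioc]
    exact Filter.Eventually.of_forall fun x hx => hb x (by linarith [hx.1]) (by linarith [hx.2])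

lemma f1_int {a b : ℝ} (ha : 0 ≤ a) (hab : a ≤ b) (hbp : b ≤ π) :
    IntervalIntegrable f1 MeasureTheory.volume a b := by
  apply int_of_bd _ _ ha hab hbp
  · unfold f1; fun_prop
  · intro x hx hx'
    rw [f1_eq, abs_mul]
    have := w_bound hx hx'
    have h := s_bound hx hx'
    rw [abs_of_nonneg h.1]
    nlinarith [abs_nonneg (cos x * (sin x - x * cos x) / x^3)]

lemma f2_int {a b : ℝ} (ha : 0 ≤ a) (hab : a ≤ b) (hbp : b ≤ π) :
    IntervalIntegrable f2 MeasureTheory.volume a b := by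
  apply int_of_bd _ _ ha hab hbp
  · unfold f2; fun_prop
  · intro x hx hx'
    unfold f2
    rw [abs_mul]
    have := w_bound hx hx'
    have h := s_bound hx hx'
    have h3 : √((sin x / x)^2 - 8/(9*π^2)) ≤ 1 := by
      refine Real.sqrt_le_iff.2 ⟨by norm_num, ?_⟩
      have : 0 ≤ 8/(9*π^2) := by positivity
      nlinarith
    rw [abs_of_nonneg (sqrt_nonneg _)]
    nlinarith [abs_nonneg (cos x * (sin x - x * cos x) / x^3),
      sqrt_nonneg ((sin x / x)^2 - 8/(9*π^2))]

lemma I1_eq : (∫ φ in (0:ℝ)..(2*π),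
        Real.sqrt (2 - 2*Real.cos φ) * (2*Real.sin φ - φ*Real.cos φ - φ) / φ^4)
    = ∫ x in (0:ℝ)..π, f1 x := by
  have h := intervalIntegral.mul_integral_comp_mul_left (a := 0) (b := π)
    (f := fun φ => Real.sqrt (2 - 2*Real.cos φ) * (2*Real.sin φ - φ*Real.cos φ - φ) / φ^4) 2
  rw [mul_zero] at h
  rw [← h, ← intervalIntegral.integral_const_mul]
  apply intervalIntegral.integral_congr
  intro x hx
  rw [Set.uIcc_of_le pi_pos.le] at hx
  simp only
  have hs := sin_nonneg_of_nonneg_of_le_pi hx.1 hx.2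
  have : 2 - 2 * cos (2*x) = (2 * sin x)^2 := by
    rw [cos_two_mul, ← sin_sq_add_cos_sq x]; nlinarith [sin_sq_add_cos_sq x]
  rw [this, sqrt_sq (by positivity), sin_two_mul, cos_two_mul]
  unfold f1
  rcases eq_or_lt_of_le hx.1 with h0 | h0
  · simp [← h0]
  · field_simp; ring

lemma I2_eq : (∫ φ in (0:ℝ)..(3*π/2),
          Real.sqrt ((2 - 2*Real.cos φ)/φ^2 - 8/(9*π^2)) *
            (2*Real.sin φ - φ*Real.cos φ - φ) / φ^3)
    = ∫ x in (0:ℝ)..(3*π/4), f2 x := by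
  have h := intervalIntegral.mul_integral_comp_mul_left (a := 0) (b := 3*π/4)
    (f := fun φ => Real.sqrt ((2 - 2*Real.cos φ)/φ^2 - 8/(9*π^2)) *
            (2*Real.sin φ - φ*Real.cos φ - φ) / φ^3) 2
  rw [mul_zero, show 2 * (3*π/4) = 3*π/2 by ring] at h
  rw [← h, ← intervalIntegral.integral_const_mul]
  apply intervalIntegral.integral_congr
  intro x hx
  simp only
  have : (2 - 2 * cos (2*x)) / (2*x)^2 = (sin x / x)^2 := by
    have : 2 - 2 * cos (2*x) = (2 * sin x)^2 := by
      rw [cos_two_mul, ← sin_sq_add_cos_sq x]; nlinarith [sin_sq_add_cos_sq x]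
    rw [this, div_pow, mul_pow, mul_pow]
    rw [mul_div_mul_left _ _ (by norm_num)]
  rw [this, sin_two_mul, cos_two_mul]
  unfold f2
  generalize √((sin x / x)^2 - 8/(9*π^2)) = r
  by_cases h0 : x = 0
  · simp [h0]
  · field_simp; ring

lemma boundA {x : ℝ} (hx : 0 < x) (hx' : x < π/2) :
    f1 x - f2 x ≤ 16/1000 * ((1 - x^2/2 + x^4/24) * (1 + 132/1000 * x^2)) := by
  have hp1 := pi_gt_d4
  have hp2 := pi_lt_d4
  have hx2 : x^2 ≤ 24676/10000 := by nlinarith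
  rw [f1_eq]; unfold f2
  set w := cos x * (sin x - x * cos x) / x^3 with hw
  have hd := d_nonneg hx.le (by linarith)
  have hc : 0 ≤ cos x := cos_nonneg_of_mem_Icc ⟨by linarith, hx'.le⟩
  have hw0 : 0 ≤ w := by positivity
  set s := sin x / x with hs
  have hs1 : 2/π ≤ s := by
    rw [hs, le_div_iff₀ hx]; exact mul_le_sin hx.le hx'.le
  have hs0 : 0 < s := lt_of_lt_of_le (by positivity) hs1
  have hs2 : 1 - x^2/6 ≤ s := by
    rw [hs, le_div_iff₀ hx]; linarith [sin_ge_sub_cube hx.le]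
  have hK : s - 48/1000/s ≤ √(s^2 - 8/(9*π^2)) := by
    apply Real.le_sqrt_of_sq_le
    have e : (s - 48/1000/s)^2 = s^2 - 96/1000 + (48/1000)^2 / s^2 := by
      field_simp; ring
    rw [e]
    have h1 : (48/1000)^2 / s^2 ≤ (48/1000)^2 * (π^2/4) := by
      rw [div_le_iff₀ (by positivity)]
      have : 1 ≤ s * (π/2) := by
        have := mul_le_mul_of_nonneg_right hs1 (by positivity : 0 ≤ π/2)
        have e2 : 2/π*(π/2) = 1 := by field_simp
        linarith
      nlinarith
    have h2 : 8/(9*π^2) ≤ 9008/100000 := by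
      rw [div_le_iff₀ (by positivity)]; nlinarith
    have h3 : π^2 ≤ 987/100 := by nlinarith
    nlinarith
  have hA : s * w - √(s^2 - 8/(9*π^2)) * w ≤ 48/1000 * (w / s) := by
    have := mul_le_mul_of_nonneg_right hK hw0
    have e : (s - 48/1000/s) * w = s * w - 48/1000 * (w/s) := by field_simp
    linarith
  refine hA.trans ?_
  have hcu := cos_up hx.le
  have hdu : (sin x - x * cos x) / x^3 ≤ 1/3 * (1 - x^2/10 + x^4/240) := by
    rw [div_le_iff₀ (by positivity)]
    have := mul_le_mul_of_nonneg_left (cos_low hx.le) hx.le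
    have := sin_up hx.le
    linarith
  have hg : 1 - x^2/10 + x^4/240 ≤ (1 + 132/1000*x^2) * (1 - x^2/6) := by
    nlinarith [mul_nonneg (sq_nonneg x) (by linarith : 0 ≤ 24676/10000 - x^2)]
  have hg2 : (sin x - x * cos x) / x^3 ≤ 1/3 * ((1 + 132/1000*x^2) * s) := by
    have : (1 + 132/1000*x^2) * (1 - x^2/6) ≤ (1 + 132/1000*x^2) * s :=
      mul_le_mul_of_nonneg_left hs2 (by positivity)
    linarith
  have hws : w / s ≤ (1 - x^2/2 + x^4/24) * (1/3 * (1 + 132/1000*x^2)) := by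
    rw [div_le_iff₀ hs0, hw, mul_div_assoc]
    calc _ ≤ (1 - x^2/2 + x^4/24) * (1/3 * ((1 + 132/1000*x^2) * s)) :=
          mul_le_mul hcu hg2 (by positivity) (hc.trans hcu)
      _ = _ := by ring
  linarith

lemma boundB {x : ℝ} (hx : π/2 < x) (hx' : x < 3*π/4) :
    f1 x - f2 x ≤ -(18/1000 * (x - π/2)) := by
  have hp1 := pi_gt_d4
  have hp2 := pi_lt_d4
  have hx0 : 0 < x := by linarith
  obtain ⟨u, hu⟩ : ∃ u, u = x - π/2 := ⟨_, rfl⟩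
  have hxu : x = u + π/2 := by linarith
  have hu0 : 0 < u := by linarith
  have hu1 : u < 7854/10000 := by linarith
  have hsx : sin x = cos u := by rw [hxu, sin_add_pi_div_two]
  have hcx : cos x = - sin u := by rw [hxu, cos_add_pi_div_two]
  rw [f1_eq]; unfold f2
  rw [hsx, hcx, ← hu]
  have hcl : 1 - u^2/2 ≤ cos u := one_sub_sq_div_two_le_cos
  have hc1 : cos u ≤ 1 := cos_le_one u
  have hch : 1/2 ≤ cos u := by nlinarith
  have hsl := sin_ge_sub_cube hu0.le
  have hsl0 : 0 < u - u^3/6 := by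
    have : 0 < u * (1 - u^2/6) := mul_pos hu0 (by nlinarith)
    linarith
  have hsu : 0 < sin u := by linarith
  set s := cos u / x with hs
  have hs0 : 0 < s := by positivity
  have hc2 : 9/100 ≤ 8/(9*π^2) := by
    rw [le_div_iff₀ (by positivity)]; nlinarith
  have hc3 : 8/(9*π^2) ≤ 2 * s^2 := by
    have : 2/(3*π) ≤ s := by
      rw [hs, div_le_div_iff₀ (by positivity) hx0]
      nlinarith
    have h2 : (2/(3*π))^2 ≤ s^2 := by gcongr
    have e : 8/(9*π^2) = 2 * (2/(3*π))^2 := by field_simp; norm_num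
    linarith
  set C := 8/(9*π^2)
  have hK : √(s^2 - C) ≤ s - C/(2*s) := by
    apply Real.sqrt_le_iff.2
    constructor
    · rw [sub_nonneg, div_le_iff₀ (by positivity)]; linarith
    · have e : (s - C/(2*s))^2 = s^2 - C + (C/(2*s))^2 := by field_simp; ring
      rw [e]; linarith [sq_nonneg (C/(2*s))]
  set v := sin u * (cos u + x * sin u) / x^3 with hv
  have hv0 : 0 ≤ v := by positivity
  have ev : -sin u * (cos u - x * -sin u) / x^3 = -v := by rw [hv]; ring
  rw [ev]
  have h1 : s * -v - √(s^2 - C) * -v ≤ -(C/(2*s) * v) := by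
    have := mul_le_mul_of_nonneg_right hK hv0
    linarith
  refine h1.trans (neg_le_neg ?_)
  have h2 : 4/10 * u ≤ v / s := by
    have e : v / s = sin u * (cos u + x * sin u) / (x^2 * cos u) := by
      rw [hv, hs]; field_simp
    rw [e, le_div_iff₀ (by positivity)]
    have h3 : (u - u^3/6) * (1 + x * (u - u^3/6)) ≤ sin u * (1 + x * sin u) := by
      gcongr
    have h4 : 4/10 * u * x^2 ≤ (u - u^3/6) * (1 + x * (u - u^3/6)) := by
      have h5 : 4/10 * x^2 ≤ (1 - u^2/6) * (1 + x * (u - u^3/6)) := by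
        have q := poly_p1 hu0 hu1
        have q1 : x^2 ≤ (15708/10000+u)^2 := by gcongr; linarith
        have q2 : 157075/100000+u ≤ x := by linarith
        have q0 : 0 ≤ 1 - u^2/6 := by nlinarith
        have q3 : (1 - u^2/6) * (1 + (157075/100000+u) * (u - u^3/6))
          ≤ (1 - u^2/6) * (1 + x * (u - u^3/6)) := by gcongr
        linarith
      have := mul_le_mul_of_nonneg_left h5 hu0.le
      linarith
    have h6 : sin u * (1 + x * sin u) * cos u ≤ sin u * (cos u + x * sin u) := by
      have : 0 ≤ sin u * (x * sin u) * (1 - cos u) :=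
        mul_nonneg (by positivity) (by linarith)
      linarith
    have h7 := mul_le_mul_of_nonneg_right (h4.trans h3) (by linarith : 0 ≤ cos u)
    linarith
  have e3 : C/(2*s) * v = C/2 * (v/s) := by field_simp
  rw [e3]
  nlinarith

lemma boundC {x : ℝ} (hx : 3*π/4 < x) (hx' : x < π) :
    f1 x ≤ -((π - x) * (32/1000 + 18/1000*(π - x))) := by
  have hp1 := pi_gt_d4
  have hp2 := pi_lt_d4
  obtain ⟨t, ht⟩ : ∃ t, t = π - x := ⟨_, rfl⟩
  have hxt : x = π - t := by linarith
  have ht0 : 0 < t := by linarith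
  have ht1 : t < 7854/10000 := by linarith
  have hx0 : 0 < x := by linarith
  have hsx : sin x = sin t := by rw [hxt, sin_pi_sub]
  have hcx : cos x = - cos t := by rw [hxt, cos_pi_sub]
  unfold f1
  rw [hsx, hcx, ← ht]
  have e : sin t * -cos t * (sin t - x * -cos t) / x^4
      = -(sin t * cos t * (sin t + x * cos t) / x^4) := by ring
  rw [e]
  apply neg_le_neg
  rw [le_div_iff₀ (by positivity)]
  have hcl : 1 - t^2/2 ≤ cos t := one_sub_sq_div_two_le_cos
  have hcl0 : 0 < 1 - t^2/2 := by nlinarith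
  have hsl := sin_ge_sub_cube ht0.le
  have hsl0 : 0 < t - t^3/6 := by
    have : 0 < t * (1 - t^2/6) := mul_pos ht0 (by nlinarith)
    linarith
  have h3 : (t - t^3/6) * (1 - t^2/2) * ((t - t^3/6) + x * (1 - t^2/2))
      ≤ sin t * cos t * (sin t + x * cos t) := by
    have : 0 < sin t := by linarith
    have : 0 < cos t := by linarith
    have : 0 < sin t * cos t := by positivity
    gcongr
  refine le_trans ?_ h3
  have hx4 : x^4 ≤ (31416/10000 - t)^4 := by
    gcongr; linarith
  have hxl : 31415/10000 - t ≤ x := by linarith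
  have h5 : (32/1000 + 18/1000*t) * (31416/10000 - t)^4
    ≤ (1 - t^2/6) * (1 - t^2/2) * ((t - t^3/6) + (31415/10000 - t) * (1 - t^2/2)) := poly_p2 ht0 ht1
  have h6 : (32/1000 + 18/1000*t) * x^4 ≤ (32/1000 + 18/1000*t) * (31416/10000 - t)^4 := by
    gcongr
  have h8 : 0 ≤ 1 - t^2/6 := by nlinarith
  have h7 : (1 - t^2/6) * (1 - t^2/2) * ((t - t^3/6) + (31415/10000 - t) * (1 - t^2/2))
     ≤ (1 - t^2/6) * (1 - t^2/2) * ((t - t^3/6) + x * (1 - t^2/2)) := by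
    gcongr
  have := mul_le_mul_of_nonneg_left (h6.trans (h5.trans h7)) ht0.le
  linarith

lemma boundD {x : ℝ} (hx : 0 < x) (hx' : x < 1) : 1/3 * (1 - 8/10 * x^2) ≤ f1 x := by
  rw [f1, le_div_iff₀ (by positivity)]
  have h1 := sin_ge_sub_cube hx.le
  have h2 : 1 - x^2/2 ≤ cos x := one_sub_sq_div_two_le_cos
  have hx2 : x^2 < 1 := by nlinarith
  have h3 : x^3 * (1/3 - x^2/24) ≤ sin x - x * cos x := by
    have := mul_le_mul_of_nonneg_left (cos_up hx.le) hx.le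
    linarith
  have h4 : 0 < 1 - x^2/2 := by linarith
  have h5 : 0 < x * (1 - x^2/6) := mul_pos hx (by linarith)
  have h6 : 0 < x^3 * (1/3 - x^2/24) := mul_pos (by positivity) (by linarith)
  have h7 : x * (1 - x^2/6) * (1 - x^2/2) * (x^3 * (1/3 - x^2/24)) ≤
     sin x * cos x * (sin x - x * cos x) := by
    have : x * (1 - x^2/6) ≤ sin x := by linarith
    have : 0 < sin x := by linarith
    have : 0 < cos x := by linarith
    have : 0 < sin x * cos x := by positivity
    gcongr
  refine le_trans ?_ h7
  have h8 : 1/3 * (1 - 8/10 * x^2) ≤ (1 - x^2/6) * (1 - x^2/2) * (1/3 - x^2/24) := by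
    nlinarith [mul_nonneg (sq_nonneg x) (sq_nonneg x), mul_nonneg (mul_nonneg (sq_nonneg x) (sq_nonneg x)) (by linarith : 0 ≤ 1 - x^2)]
  have := mul_le_mul_of_nonneg_left h8 (by positivity : 0 ≤ x^4)
  linarith

lemma boundE {x : ℝ} (hx : 1 < x) (hx' : x < π/2) : 0 ≤ f1 x := by
  have hp := pi_pos
  have hd := d_nonneg (by linarith : 0 ≤ x) (by linarith)
  have hc : 0 ≤ cos x := cos_nonneg_of_mem_Icc ⟨by linarith, hx'.le⟩
  have hs := sin_nonneg_of_nonneg_of_le_pi (by linarith : 0 ≤ x) (by linarith)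
  unfold f1; positivity

lemma boundF {x : ℝ} (hx : π/2 < x) (hx' : x < π) : -(38/100 - 105/1000 * x) ≤ f1 x := by
  have hp1 := pi_gt_d4
  have hp2 := pi_lt_d4
  have hx0 : 0 < x := by linarith
  rw [f1, le_div_iff₀ (by positivity)]
  have hd := d_nonneg (by linarith : 0 ≤ x) (by linarith)
  have hd2 : sin x - x * cos x ≤ 1 + x := by
    nlinarith [sin_le_one x, neg_one_le_cos x]
  have hsc : -(1/2) ≤ sin x * cos x := by
    nlinarith [sq_nonneg (sin x + cos x), sin_sq_add_cos_sq x]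
  have h1 : -(1/2) * (1 + x) ≤ sin x * cos x * (sin x - x * cos x) := by
    nlinarith
  refine le_trans ?_ h1
  have h2 : 1/2 * (1 + x) ≤ (38/100 - 105/1000*x) * x^4 := poly_p3 (by linarith) (by linarith)
  linarith

theorem main1 : (∫ x in (0:ℝ)..π, f1 x) < ∫ x in (0:ℝ)..(3*π/4), f2 x := by
  have hp := pi_pos
  have hp1 := pi_gt_d4
  have hp2 := pi_lt_d4
  rw [← intervalIntegral.integral_add_adjacent_intervals (a := 0) (b := π/2) (c := π) (f := f1)
      (f1_int (by linarith) (by linarith) (by linarith))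
      (f1_int (by linarith) (by linarith) (by linarith)),
    ← intervalIntegral.integral_add_adjacent_intervals (a := π/2) (b := 3*π/4) (c := π) (f := f1)
      (f1_int (by linarith) (by linarith) (by linarith))
      (f1_int (by linarith) (by linarith) (by linarith)),
    ← intervalIntegral.integral_add_adjacent_intervals (a := 0) (b := π/2) (c := 3*π/4) (f := f2)
      (f2_int (by linarith) (by linarith) (by linarith))
      (f2_int (by linarith) (by linarith) (by linarith))]
  have i1 := f1_int (a := 0) (b := π/2) (by linarith) (by linarith) (by linarith)
  have j1 := f2_int (a := 0) (b := π/2) (by linarith) (by linarith) (by linarith)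
  have i2 := f1_int (a := π/2) (b := 3*π/4) (by linarith) (by linarith) (by linarith)
  have j2 := f2_int (a := π/2) (b := 3*π/4) (by linarith) (by linarith) (by linarith)
  have i3 := f1_int (a := 3*π/4) (b := π) (by linarith) (by linarith) (by linarith)
  have A := intervalIntegral.integral_mono_on_of_le_Ioo (a := 0) (b := π/2) (by linarith)
    (i1.sub j1) (Continuous.intervalIntegrable (by fun_prop) _ _)
    (fun x hx => boundA hx.1 hx.2)
  have B := intervalIntegral.integral_mono_on_of_le_Ioo (a := π/2) (b := 3*π/4) (by linarith)
    (i2.sub j2) (Continuous.intervalIntegrable (by fun_prop) _ _)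
    (fun x hx => boundB hx.1 hx.2)
  have C := intervalIntegral.integral_mono_on_of_le_Ioo (a := 3*π/4) (b := π) (by linarith)
    i3 (Continuous.intervalIntegrable (by fun_prop) _ _)
    (fun x hx => boundC hx.1 hx.2)
  rw [intervalIntegral.integral_sub i1 j1] at A
  rw [intervalIntegral.integral_sub i2 j2] at B
  have eA : (∫ x in (0:ℝ)..(π/2), 16/1000 * ((1 - x^2/2 + x^4/24) * (1 + 132/1000 * x^2)))
      = 16/1000 * (π/2 - 368/1000*(π/2)^3/3 + (1/24 - 66/1000)*(π/2)^5/5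
        + 132/24000*(π/2)^7/7) := by
    have := intervalIntegral.integral_eq_sub_of_hasDerivAt (a := 0) (b := π/2)
      (f := fun x => 16/1000 * (x - 368/1000*x^3/3 + (1/24 - 66/1000)*x^5/5
        + 132/24000*x^7/7))
      (f' := fun x => 16/1000 * ((1 - x^2/2 + x^4/24) * (1 + 132/1000 * x^2)))
      (fun x _ => by
        have h := ((((hasDerivAt_id x).sub (((hasDerivAt_pow 3 x).const_mul (368/1000)).div_const 3)).add
          (((hasDerivAt_pow 5 x).const_mul (1/24-66/1000)).div_const 5)).add
          (((hasDerivAt_pow 7 x).const_mul (132/24000)).div_const 7)).const_mul (16/1000)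
        refine h.congr_deriv ?_
        norm_num; ring)
      (Continuous.intervalIntegrable (by fun_prop) _ _)
    rw [this]; ring
  have eB : (∫ x in (π/2)..(3*π/4), -(18/1000 * (x - π/2))) = -(9/1000 * (π/4)^2) := by
    have := intervalIntegral.integral_eq_sub_of_hasDerivAt (a := π/2) (b := 3*π/4)
      (f := fun x => -(9/1000 * (x-π/2)^2))
      (f' := fun x => -(18/1000 * (x - π/2)))
      (fun x _ => by
        have h := (((((hasDerivAt_id x).sub_const (π/2)).pow 2).const_mul (9/1000))).neg
        refine h.congr_deriv ?_
        norm_num; ring)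
      (Continuous.intervalIntegrable (by fun_prop) _ _)
    rw [this]; ring
  have eC : (∫ x in (3*π/4)..π, -((π - x) * (32/1000 + 18/1000*(π - x))))
      = -(16/1000 * (π/4)^2 + 6/1000 * (π/4)^3) := by
    have := intervalIntegral.integral_eq_sub_of_hasDerivAt (a := 3*π/4) (b := π)
      (f := fun x => 16/1000 * (π-x)^2 + 6/1000 * (π-x)^3)
      (f' := fun x => -((π - x) * (32/1000 + 18/1000*(π - x))))
      (fun x _ => by
        have h := ((((hasDerivAt_id x).const_sub π).pow 2).const_mul (16/1000)).add
          ((((hasDerivAt_id x).const_sub π).pow 3).const_mul (6/1000))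
        refine h.congr_deriv ?_
        norm_num; ring)
      (Continuous.intervalIntegrable (by fun_prop) _ _)
    rw [this]; ring
  rw [eA] at A; rw [eB] at B; rw [eC] at C
  have p2 : (3.1415:ℝ)^2 ≤ π^2 := by gcongr
  have p3 : (3.1415:ℝ)^3 ≤ π^3 := by gcongr
  have p5 : (3.1415:ℝ)^5 ≤ π^5 := by gcongr
  have p7 : π^7 ≤ (3.1416:ℝ)^7 := by gcongr
  norm_num at p2 p3 p5 p7 hp2
  linarith

theorem main2 : 0 < ∫ x in (0:ℝ)..π, f1 x := by
  have hp1 := pi_gt_d4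
  have hp2 := pi_lt_d4
  have i1 := f1_int (a := 0) (b := 1) (by linarith) (by linarith) (by linarith)
  have i2 := f1_int (a := 1) (b := π/2) (by linarith) (by linarith) (by linarith)
  have i3 := f1_int (a := π/2) (b := π) (by linarith) (by linarith) (by linarith)
  rw [← intervalIntegral.integral_add_adjacent_intervals (i1.trans i2) i3,
    ← intervalIntegral.integral_add_adjacent_intervals i1 i2]
  have A := intervalIntegral.integral_mono_on_of_le_Ioo (a := 0) (b := 1) (by linarith)
    (Continuous.intervalIntegrable (by fun_prop) _ _) i1
    (fun x hx => boundD hx.1 hx.2)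
  have B := intervalIntegral.integral_mono_on_of_le_Ioo (a := 1) (b := π/2) (by linarith)
    (Continuous.intervalIntegrable (continuous_const (y := (0:ℝ))) _ _) i2
    (fun x hx => boundE hx.1 hx.2)
  have C := intervalIntegral.integral_mono_on_of_le_Ioo (a := π/2) (b := π) (by linarith)
    (Continuous.intervalIntegrable (by fun_prop) _ _) i3
    (fun x hx => boundF hx.1 hx.2)
  have eA : (∫ x in (0:ℝ)..1, 1/3 * (1 - 8/10 * x^2)) = 1/3 * (1 - 8/30) := by
    have := intervalIntegral.integral_eq_sub_of_hasDerivAt (a := 0) (b := 1)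
      (f := fun x => 1/3 * (x - 8/30*x^3))
      (f' := fun x : ℝ => 1/3 * (1 - 8/10 * x^2))
      (fun x _ => by
        have h := ((hasDerivAt_id x).sub ((hasDerivAt_pow 3 x).const_mul (8/30))).const_mul (1/3)
        refine h.congr_deriv ?_
        norm_num; ring)
      (Continuous.intervalIntegrable (by fun_prop) _ _)
    rw [this]; norm_num
  have eC : (∫ x in (π/2)..π, -(38/100 - 105/1000 * x)) = -(19/100*π - 105/2000*(3/4*π^2)) := by
    have := intervalIntegral.integral_eq_sub_of_hasDerivAt (a := π/2) (b := π)
      (f := fun x => -(38/100*x - 105/2000 * x^2))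
      (f' := fun x : ℝ => -(38/100 - 105/1000 * x))
      (fun x _ => by
        have h := (((hasDerivAt_id x).const_mul (38/100)).sub
          ((hasDerivAt_pow 2 x).const_mul (105/2000))).neg
        refine h.congr_deriv ?_
        norm_num; ring)
      (Continuous.intervalIntegrable (by fun_prop) _ _)
    rw [this]; ring
  rw [eA] at A; rw [eC] at C
  simp only [intervalIntegral.integral_zero] at B
  nlinarith

/-- The two slice-area integrals satisfy the strict inequality, both are strictly
positive, and hence their ratio lies strictly between `0` and `1`. -/
theorem integral_ratio_lt_one :
    (∫ φ in (0:ℝ)..(2*π),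
        Real.sqrt (2 - 2*Real.cos φ) * (2*Real.sin φ - φ*Real.cos φ - φ) / φ^4)
      < (∫ φ in (0:ℝ)..(3*π/2),
          Real.sqrt ((2 - 2*Real.cos φ)/φ^2 - 8/(9*π^2)) *
            (2*Real.sin φ - φ*Real.cos φ - φ) / φ^3) ∧
    (0 < ∫ φ in (0:ℝ)..(2*π),
        Real.sqrt (2 - 2*Real.cos φ) * (2*Real.sin φ - φ*Real.cos φ - φ) / φ^4) ∧
    (0 < ∫ φ in (0:ℝ)..(3*π/2),
        Real.sqrt ((2 - 2*Real.cos φ)/φ^2 - 8/(9*π^2)) *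
          (2*Real.sin φ - φ*Real.cos φ - φ) / φ^3) ∧
    (0 < (∫ φ in (0:ℝ)..(2*π),
            Real.sqrt (2 - 2*Real.cos φ) * (2*Real.sin φ - φ*Real.cos φ - φ) / φ^4) /
          (∫ φ in (0:ℝ)..(3*π/2),
            Real.sqrt ((2 - 2*Real.cos φ)/φ^2 - 8/(9*π^2)) *
              (2*Real.sin φ - φ*Real.cos φ - φ) / φ^3)) ∧
    ((∫ φ in (0:ℝ)..(2*π),
        Real.sqrt (2 - 2*Real.cos φ) * (2*Real.sin φ - φ*Real.cos φ - φ) / φ^4) /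
      (∫ φ in (0:ℝ)..(3*π/2),
        Real.sqrt ((2 - 2*Real.cos φ)/φ^2 - 8/(9*π^2)) *
          (2*Real.sin φ - φ*Real.cos φ - φ) / φ^3) < 1) := by
  rw [I1_eq, I2_eq]
  have h1 := main1
  have h2 := main2
  have h3 := h2.trans h1
  exact ⟨h1, h2, h3, div_pos h2 h3, (div_lt_one h3).2 h1⟩
end
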